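/- Let k ≥ 1, s ≥ 1 and n ≥ ks+k−1, and let 𝓕 be a stable and saturated family of k-element subsets of [n] with ν(𝓕) = s. Then |𝓕| = Σ_{H ∈ 𝓕₀} C(n−ks−k+1, k−|H|), where 𝓕₀ = { F ∩ [ks+k−1] : F ∈ 𝓕 } is the trace family and C(a,b) is the binomial coefficient. -/

import Mathlib

/-- The matching number of a family of finite sets: the maximum number of
pairwise disjoint nonempty members. -/
noncomputable def matchNum (𝓕 : Finset (Finset ℕ)) : ℕ :=
  sSup {m | ∃ M ⊆ 𝓕, M.card = m ∧ (∀ A ∈ M, A.Nonempty) ∧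
    (M : Set (Finset ℕ)).Pairwise fun A B => Disjoint A B}

/-- A family of subsets of `[n] = {1,…,n}` is stable if it is closed downwards
under the "shifting" partial order: whenever `F ∈ 𝓕` and `G ⊆ [n]` admits a
bijection `φ : F → G` with `φ x ≤ x` for all `x ∈ F`, then `G ∈ 𝓕`. -/
def Stable (n : ℕ) (𝓕 : Finset (Finset ℕ)) : Prop :=
  ∀ F ∈ 𝓕, ∀ G : Finset ℕ, G ⊆ Finset.Icc 1 n → G.card = F.card →
    (∃ φ : ℕ → ℕ, Set.BijOn φ (F : Set ℕ) (G : Set ℕ) ∧ ∀ x ∈ F, φ x ≤ x) → G ∈ 𝓕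

/-- A family of `k`-element subsets of `[n]` is saturated if adding any new
`k`-element subset of `[n]` increases the matching number. -/
def Saturated (n k : ℕ) (𝓕 : Finset (Finset ℕ)) : Prop :=
  ∀ E : Finset ℕ, E ⊆ Finset.Icc 1 n → E.card = k → E ∉ 𝓕 →
    matchNum 𝓕 < matchNum (insert E 𝓕)

theorem bddAbove_matching_cards (𝓕 : Finset (Finset ℕ)) :
    BddAbove {m | ∃ M ⊆ 𝓕, M.card = m ∧ (∀ A ∈ M, A.Nonempty) ∧
      (M : Set (Finset ℕ)).Pairwise fun A B => Disjoint A B} := by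
  refine ⟨𝓕.card, ?_⟩
  rintro m ⟨M, hM, rfl, -⟩
  exact Finset.card_le_card hM

theorem card_le_matchNum {𝓕 M : Finset (Finset ℕ)} (hM : M ⊆ 𝓕) (hne : ∀ A ∈ M, A.Nonempty)
    (hd : (M : Set (Finset ℕ)).Pairwise fun A B => Disjoint A B) : M.card ≤ matchNum 𝓕 :=
  le_csSup (bddAbove_matching_cards 𝓕) ⟨M, hM, rfl, hne, hd⟩

theorem exists_matching_card_eq_matchNum (𝓕 : Finset (Finset ℕ)) :
    ∃ M ⊆ 𝓕, M.card = matchNum 𝓕 ∧ (∀ A ∈ M, A.Nonempty) ∧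
      (M : Set (Finset ℕ)).Pairwise fun A B => Disjoint A B :=
  Nat.sSup_mem (s := {m | ∃ M ⊆ 𝓕, M.card = m ∧ (∀ A ∈ M, A.Nonempty) ∧
      (M : Set (Finset ℕ)).Pairwise fun A B => Disjoint A B})
    ⟨0, ∅, by simp⟩ (bddAbove_matching_cards 𝓕)

/-- A finite set avoiding `H` can be pushed injectively and weakly downwards into `[m] \ H`,
provided that there is enough room. -/
theorem exists_injOn_le_mapsTo_sdiff (m : ℕ) (U H : Finset ℕ) (hU : ∀ x ∈ U, 1 ≤ x)
    (hUH : Disjoint U H) (hcard : U.card ≤ (Finset.Icc 1 m \ H).card) :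
    ∃ φ : ℕ → ℕ, Set.InjOn φ U ∧ ∀ x ∈ U, φ x ≤ x ∧ φ x ∈ Finset.Icc 1 m \ H := by
  set I := Finset.Icc 1 m with hI
  have hsub : U ∩ I ⊆ I \ H := by
    intro x hx
    rw [Finset.mem_inter] at hx
    exact Finset.mem_sdiff.2 ⟨hx.2, Finset.disjoint_left.1 hUH hx.1⟩
  have hroom : (U \ I).card ≤ ((I \ H) \ (U ∩ I)).card := by
    have h1 := Finset.card_sdiff_add_card_inter U I
    have h2 := Finset.card_sdiff_add_card_eq_card hsub
    omega
  obtain ⟨T, hT, hTcard⟩ := Finset.exists_subset_card_eq hroom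
  let e := Finset.equivOfCardEq hTcard.symm
  have hgT : ∀ x (h : x ∈ U \ I), (e ⟨x, h⟩ : ℕ) ∈ (I \ H) \ (U ∩ I) :=
    fun x h => hT (e ⟨x, h⟩).2
  refine ⟨fun x => if h : x ∈ U \ I then e ⟨x, h⟩ else x, ?_, ?_⟩
  · intro x hx y hy hxy
    have hx' : x ∈ U := hx
    have hy' : y ∈ U := hy
    by_cases h1 : x ∈ U \ I <;> by_cases h2 : y ∈ U \ I <;> simp only [h1, h2, dite_true,
      dite_false] at hxy
    · simpa using e.injective (Subtype.ext hxy)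
    · have := hgT x h1
      rw [hxy] at this
      simp_all
    · have := hgT y h2
      rw [← hxy] at this
      simp_all
    · exact hxy
  · intro x hx
    by_cases h : x ∈ U \ I
    · simp only [h, dite_true]
      have h3 := (Finset.mem_sdiff.1 (hgT x h)).1
      refine ⟨?_, h3⟩
      have h4 := (Finset.mem_sdiff.1 h3).1
      have h5 := (Finset.mem_sdiff.1 h).2
      have h6 := hU x hx
      have h7 := (Finset.mem_Icc.1 h4).2
      rw [hI, Finset.mem_Icc] at h5
      omega
    · simp only [h, dite_false]
      refine ⟨le_rfl, hsub ?_⟩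
      simp_all

/-- Membership in a stable saturated family with matching number `s` depends only on the
trace on `[ks+k-1]`. -/
theorem mem_of_inter_eq {k s n : ℕ} (hk : 1 ≤ k) (hn : k * s + k - 1 ≤ n)
    {𝓕 : Finset (Finset ℕ)} (h𝓕 : 𝓕 ⊆ Finset.powersetCard k (Finset.Icc 1 n))
    (hst : Stable n 𝓕) (hsat : Saturated n k 𝓕) (hν : matchNum 𝓕 = s)
    {F E : Finset ℕ} (hF : F ∈ 𝓕) (hE : E ⊆ Finset.Icc 1 n) (hEk : E.card = k)
    (hFE : F ∩ Finset.Icc 1 (k * s + k - 1) = E ∩ Finset.Icc 1 (k * s + k - 1)) : E ∈ 𝓕 := by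
  by_contra hEF
  have hlt := hsat E hE hEk hEF
  obtain ⟨M, hM, hMcard, hMne, hMd⟩ := exists_matching_card_eq_matchNum (insert E 𝓕)
  rw [← hMcard, hν] at hlt
  have hM' : M.erase E ⊆ 𝓕 := by rwa [← Finset.subset_insert_iff]
  have hM'd : ((M.erase E : Finset (Finset ℕ)) : Set (Finset ℕ)).Pairwise
      fun A B => Disjoint A B := hMd.mono (by simp)
  have hM'card := card_le_matchNum hM' (fun A hA => hMne A (Finset.mem_of_mem_erase hA)) hM'd
  have hEM : E ∈ M := by
    by_contra h
    rw [Finset.erase_eq_of_notMem h] at hM'card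
    omega
  have hM's : (M.erase E).card = s := by
    have := Finset.card_erase_add_one hEM
    omega
  set N := M.erase E with hN
  set I := Finset.Icc 1 (k * s + k - 1) with hI
  have hcardk : ∀ A ∈ 𝓕, A.card = k := fun A hA => (Finset.mem_powersetCard.1 (h𝓕 hA)).2
  have hsubn : ∀ A ∈ 𝓕, A ⊆ Finset.Icc 1 n := fun A hA => (Finset.mem_powersetCard.1 (h𝓕 hA)).1
  have hlt' : (E ∩ I).card < k := by
    rw [← hEk]
    refine Finset.card_lt_card (Finset.inter_subset_left.ssubset_of_ne fun h => hEF ?_)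
    have hEsub : E ⊆ F := by
      rw [← h, ← hFE]
      exact Finset.inter_subset_left
    rwa [Finset.eq_of_subset_of_card_le hEsub (by rw [hcardk F hF, hEk])]
  have hUcard : (N.biUnion id).card ≤ (I \ (E ∩ I)).card := by
    have h1 : (N.biUnion id).card ≤ N.card * k :=
      Finset.card_biUnion_le_card_mul _ _ _ fun A hA => (hcardk A (hM' hA)).le
    have h2 := Finset.card_sdiff_add_card_eq_card (Finset.inter_subset_right : E ∩ I ⊆ I)
    have h3 : I.card = k * s + k - 1 := by simp [hI]
    rw [hM's, mul_comm] at h1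
    omega
  obtain ⟨φ, hφinj, hφ⟩ := exists_injOn_le_mapsTo_sdiff (k * s + k - 1) (N.biUnion id) (E ∩ I)
    (by
      intro x hx
      obtain ⟨A, hA, hxA⟩ := Finset.mem_biUnion.1 hx
      exact (Finset.mem_Icc.1 (hsubn A (hM' hA) hxA)).1)
    (by
      rw [Finset.disjoint_biUnion_left]
      intro A hA
      exact (hMd (Finset.mem_of_mem_erase hA) hEM (Finset.ne_of_mem_erase hA)).mono_right
        Finset.inter_subset_left)
    hUcard
  have hAU : ∀ A ∈ N, A ⊆ N.biUnion id := fun A hA => Finset.subset_biUnion_of_mem id hA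
  have hneN : ∀ A ∈ N, A.Nonempty := fun A hA => hMne A (Finset.mem_of_mem_erase hA)
  have himg : ∀ A ∈ N, A.image φ ⊆ I \ (E ∩ I) := by
    intro A hA
    rw [Finset.image_subset_iff]
    exact fun x hx => (hφ x (hAU A hA hx)).2
  have hdimg : ∀ A ∈ N, ∀ B ∈ N, A ≠ B → Disjoint (A.image φ) (B.image φ) := by
    intro A hA B hB hAB
    rw [Finset.disjoint_left]
    intro y hyA hyB
    obtain ⟨a, ha, rfl⟩ := Finset.mem_image.1 hyA
    obtain ⟨b, hb, hba⟩ := Finset.mem_image.1 hyB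
    have hab : b = a := hφinj (hAU B hB hb) (hAU A hA ha) hba
    subst hab
    exact Finset.disjoint_left.1 (hM'd hA hB hAB) ha hb
  have himgmem : ∀ A ∈ N, A.image φ ∈ 𝓕 := by
    intro A hA
    have hinj : Set.InjOn φ (A : Set ℕ) := hφinj.mono (hAU A hA)
    refine hst A (hM' hA) _ ?_ (Finset.card_image_of_injOn hinj)
      ⟨φ, ?_, fun x hx => (hφ x (hAU A hA hx)).1⟩
    · exact ((himg A hA).trans Finset.sdiff_subset).trans (Finset.Icc_subset_Icc_right hn)
    · rw [Finset.coe_image]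
      exact hinj.bijOn_image
  have hFd : ∀ A ∈ N, Disjoint F (A.image φ) := by
    intro A hA
    rw [Finset.disjoint_left]
    intro x hxF hxA
    have h1 := Finset.mem_sdiff.1 (himg A hA hxA)
    rw [← hFE] at h1
    exact h1.2 (Finset.mem_inter.2 ⟨hxF, h1.1⟩)
  have hFne : F.Nonempty := Finset.card_pos.1 (by rw [hcardk F hF]; omega)
  have hFN : F ∉ N.image (Finset.image φ) := by
    intro h
    obtain ⟨A, hA, rfl⟩ := Finset.mem_image.1 h
    exact hFne.ne_empty (disjoint_self.1 (hFd A hA))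
  have hinjN : Set.InjOn (Finset.image φ) (N : Set (Finset ℕ)) := by
    intro A hA B hB hAB
    by_contra hne
    have := hdimg A hA B hB hne
    rw [← hAB] at this
    exact ((hneN A hA).image φ).ne_empty (disjoint_self.1 this)
  have hfinal := card_le_matchNum (𝓕 := 𝓕) (M := insert F (N.image (Finset.image φ)))
    (by
      rw [Finset.insert_subset_iff, Finset.image_subset_iff]
      exact ⟨hF, himgmem⟩)
    (by
      simp only [Finset.forall_mem_insert, Finset.forall_mem_image]
      exact ⟨hFne, fun A hA => (hneN A hA).image φ⟩)
    (by
      rw [Finset.coe_insert, Set.pairwise_insert]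
      refine ⟨?_, ?_⟩
      · rw [Finset.coe_image]
        rintro _ ⟨A, hA, rfl⟩ _ ⟨B, hB, rfl⟩ hAB
        exact hdimg A hA B hB fun h => hAB (h ▸ rfl)
      · rw [Finset.coe_image]
        rintro _ ⟨A, hA, rfl⟩ -
        exact ⟨hFd A hA, (hFd A hA).symm⟩)
  rw [Finset.card_insert_of_notMem hFN, Finset.card_image_of_injOn hinjN] at hfinal
  omega

/-- The number of `k`-subsets of `[n]` with a prescribed trace `H` on `[m]`. -/
theorem card_filter_inter_eq {k m n : ℕ} (hmn : m ≤ n) {H : Finset ℕ}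
    (hH : H ⊆ Finset.Icc 1 m) (hHk : H.card ≤ k) :
    ((Finset.powersetCard k (Finset.Icc 1 n)).filter
      fun E => E ∩ Finset.Icc 1 m = H).card = (n - m).choose (k - H.card) := by
  have hdisj : Disjoint (Finset.Icc 1 m) (Finset.Ioc m n) := by
    rw [Finset.disjoint_left]
    intro x hx
    simp only [Finset.mem_Icc, Finset.mem_Ioc] at hx ⊢
    omega
  rw [← Nat.card_Ioc m n, ← Finset.card_powersetCard]
  refine Finset.card_nbij' (· \ H) (· ∪ H) ?_ ?_ ?_ ?_
  · intro E hE
    simp only [Finset.coe_filter, Finset.mem_powersetCard, Set.mem_ofPred_eq] at hE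
    obtain ⟨⟨hEn, hEk⟩, rfl⟩ := hE
    simp only [Finset.mem_coe, Finset.mem_powersetCard]
    refine ⟨?_, by rw [Finset.card_sdiff_of_subset Finset.inter_subset_left, hEk]⟩
    intro x hx
    have := @hEn x
    simp only [Finset.mem_sdiff, Finset.mem_inter, Finset.mem_Icc, Finset.mem_Ioc] at *
    grind
  · intro G hG
    simp only [Finset.mem_coe, Finset.mem_powersetCard] at hG
    have hGI := hdisj.symm.mono_left hG.1
    simp only [Finset.coe_filter, Finset.mem_powersetCard, Set.mem_ofPred_eq]
    refine ⟨⟨Finset.union_subset (fun x hx => ?_)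
      (hH.trans (Finset.Icc_subset_Icc_right hmn)), ?_⟩, ?_⟩
    · have := Finset.mem_Ioc.1 (hG.1 hx)
      rw [Finset.mem_Icc]
      omega
    · rw [Finset.card_union_of_disjoint (hGI.mono_right hH)]
      omega
    · rw [Finset.union_inter_distrib_right, Finset.disjoint_iff_inter_eq_empty.1 hGI,
        Finset.empty_union, Finset.inter_eq_left.2 hH]
  · intro E hE
    simp only [Finset.coe_filter, Set.mem_ofPred_eq] at hE
    exact Finset.sdiff_union_of_subset (hE.2 ▸ Finset.inter_subset_left)
  · intro G hG
    simp only [Finset.mem_coe, Finset.mem_powersetCard] at hG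
    exact Finset.union_sdiff_cancel_right ((hdisj.symm.mono_left hG.1).mono_right hH)

/-- For a stable, saturated family `𝓕` of `k`-subsets of `[n]` with `ν(𝓕) = s`,
`|𝓕| = Σ_{H ∈ 𝓕₀} C(n−ks−k+1, k−|H|)` where `𝓕₀` is the trace family on
`[ks+k−1]`. -/
theorem size_formula_from_trace (k s n : ℕ) (hk : 1 ≤ k) (hs : 1 ≤ s)
    (hn : k * s + k - 1 ≤ n)
    (𝓕 : Finset (Finset ℕ)) (h𝓕 : 𝓕 ⊆ Finset.powersetCard k (Finset.Icc 1 n))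
    (hst : Stable n 𝓕) (hsat : Saturated n k 𝓕) (hν : matchNum 𝓕 = s) :
    𝓕.card = ∑ H ∈ 𝓕.image (fun F => F ∩ Finset.Icc 1 (k * s + k - 1)),
      (n + 1 - (k * s + k)).choose (k - H.card) := by
  rw [Finset.card_eq_sum_card_image (fun F => F ∩ Finset.Icc 1 (k * s + k - 1)) 𝓕]
  refine Finset.sum_congr rfl fun H hH => ?_
  obtain ⟨F, hF, rfl⟩ := Finset.mem_image.1 hH
  have hFk := (Finset.mem_powersetCard.1 (h𝓕 hF)).2
  rw [show n + 1 - (k * s + k) = n - (k * s + k - 1) by omega,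
    ← card_filter_inter_eq hn Finset.inter_subset_right
      (hFk ▸ Finset.card_le_card Finset.inter_subset_left)]
  congr 1
  ext E
  simp only [Finset.mem_filter]
  refine ⟨fun h => ⟨h𝓕 h.1, h.2⟩, fun h => ⟨?_, h.2⟩⟩
  have hE := Finset.mem_powersetCard.1 h.1
  exact mem_of_inter_eq hk hn h𝓕 hst hsat hν hF hE.1 hE.2 h.2.symm
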